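/- Let Q be the 3-dimensional real Leibniz algebra with bracket determined by [g,e]=f and [g,g]=e (all other brackets of basis vectors zero). A linear map N : Q → Q is a Nijenhuis operator on Q if and only if its matrix (rows = coordinates of N(e), N(f), N(g) in the basis {e,f,g}) has the form with rows (k₁,k₂,0), (0,k₁,0), (p₁,p₂,k₁) for some real parameters k₁, k₂, p₁, p₂. -/

import Mathlib

/-- Bracket of the 3-dim real Leibniz algebra with [g,e]=f, [g,g]=e
(basis e,f,g ↔ indices 0,1,2). -/
noncomputable def br (x y : Fin 3 → ℝ) : Fin 3 → ℝ :=
  ![x 2 * y 2, x 2 * y 0, 0]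

/-- A linear map on `ℝ³` is determined by the images of the standard basis vectors. -/
lemma map_eq_of_basis (N : (Fin 3 → ℝ) →ₗ[ℝ] (Fin 3 → ℝ)) (v : Fin 3 → ℝ) :
    N v = v 0 • N ![1,0,0] + v 1 • N ![0,1,0] + v 2 • N ![0,0,1] := by
  simp only [← map_smul, ← map_add]
  congr 1
  ext i
  fin_cases i <;> simp

theorem nijenhuis_classification_thm2_12 (N : (Fin 3 → ℝ) →ₗ[ℝ] (Fin 3 → ℝ)) :
    (∀ x y, br (N x) (N y) + N (N (br x y)) = N (br (N x) y) + N (br x (N y)))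
    ↔
    (∃ k₁ k₂ p₁ p₂ : ℝ,
      N ![1,0,0] = ![k₁,k₂,0] ∧ N ![0,1,0] = ![0,k₁,0] ∧ N ![0,0,1] = ![p₁,p₂,k₁]) := by
  constructor
  · intro h
    obtain ⟨k₁, k₂, k₃, hk⟩ : ∃ a b c : ℝ, N ![1,0,0] = ![a,b,c] :=
      ⟨_, _, _, (FinVec.etaExpand_eq (N ![1,0,0])).symm⟩
    obtain ⟨l₁, l₂, l₃, hl⟩ : ∃ a b c : ℝ, N ![0,1,0] = ![a,b,c] :=
      ⟨_, _, _, (FinVec.etaExpand_eq (N ![0,1,0])).symm⟩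
    obtain ⟨p₁, p₂, p₃, hp⟩ : ∃ a b c : ℝ, N ![0,0,1] = ![a,b,c] :=
      ⟨_, _, _, (FinVec.etaExpand_eq (N ![0,0,1])).symm⟩
    have hN : ∀ a b c : ℝ, N ![a,b,c] = ![a * k₁ + b * l₁ + c * p₁,
        a * k₂ + b * l₂ + c * p₂, a * k₃ + b * l₃ + c * p₃] := by
      intro a b c
      rw [map_eq_of_basis, hk, hl, hp]
      simp
    have hee := h ![1,0,0] ![1,0,0]
    have hff := h ![0,1,0] ![0,1,0]
    have hgf := h ![0,0,1] ![0,1,0]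
    have hge := h ![0,0,1] ![1,0,0]
    have hgg := h ![0,0,1] ![0,0,1]
    simp [br, hN] at hee hff hgf hge hgg
    have hl₃ : l₃ = 0 := by grind
    have hl₁ : l₁ = 0 := by grind
    have hk₃ : k₃ = 0 := by grind
    subst hl₃ hl₁ hk₃
    have hp₃ : p₃ = k₁ := by
      have : (p₃ - k₁) ^ 2 = 0 := by grind
      grind
    have hl₂ : l₂ = k₁ := by grind
    subst hp₃ hl₂
    exact ⟨_, _, _, _, hk, hl, hp⟩
  · rintro ⟨k₁, k₂, p₁, p₂, hk, hl, hp⟩ x y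
    have hN : ∀ v, N v = ![v 0 * k₁ + v 2 * p₁,
        v 0 * k₂ + v 1 * k₁ + v 2 * p₂, v 2 * k₁] := by
      intro v
      rw [map_eq_of_basis, hk, hl, hp]
      simp
    ext i
    fin_cases i <;> simp [br, hN] <;> ring
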